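/- Let L be a free abelian group of rank 2n with an action of the dihedral group D = ⟨t,u⟩ of order 8 whose central involution acts as -1. In the quotient (1/2)Tel(t)/2Tel(t) (working inside ℚ⊗L), let A(t) and A(u) denote the images of the commutator maps, i.e., A(g) = ((1/2)Tel(t))(g-1) + 2Tel(t) / 2Tel(t). Then A(t) ∩ A(u) = 0. -/

import Mathlib

open scoped TensorProduct

/-- The `+1`-eigenlattice of an involution `t` on `L`. -/
def eigP {L : Type*} [AddCommGroup L] (t : Module.End ℤ L) : Submodule ℤ L :=
  LinearMap.ker (t - 1)

/-- The `-1`-eigenlattice of an involution `t` on `L`. -/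
def eigM {L : Type*} [AddCommGroup L] (t : Module.End ℤ L) : Submodule ℤ L :=
  LinearMap.ker (t + 1)

/-- The total eigenlattice `Tel(t) = L^+(t) + L^-(t)`. -/
def Tel {L : Type*} [AddCommGroup L] (t : Module.End ℤ L) : Submodule ℤ L :=
  eigP t ⊔ eigM t


/-- The doubled total eigenlattice `2·Tel(t)`. -/
def twoTel {L : Type*} [AddCommGroup L] (t : Module.End ℤ L) : Submodule ℤ L :=
  Submodule.map ((2 : ℤ) • (1 : Module.End ℤ L)) (Tel t)

/-- The canonical map `L → ℚ ⊗ L`. -/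
noncomputable def toQL (L : Type*) [AddCommGroup L] : L →ₗ[ℤ] ℚ ⊗[ℤ] L :=
  TensorProduct.mk ℤ ℚ L 1

/-- `½·Tel(t)` inside `V = ℚ ⊗ L`. -/
noncomputable def halfTelV {L : Type*} [AddCommGroup L] (t : Module.End ℤ L) :
    Submodule ℤ (ℚ ⊗[ℤ] L) :=
  Submodule.map (((2 : ℚ)⁻¹) • toQL L) (Tel t)

/-- `2·Tel(t)` inside `V = ℚ ⊗ L`. -/
noncomputable def twoTelV {L : Type*} [AddCommGroup L] (t : Module.End ℤ L) :
    Submodule ℤ (ℚ ⊗[ℤ] L) :=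
  Submodule.map (toQL L) (twoTel t)

/-- The commutator module `A(g) = (½Tel(t)(g-1) + 2Tel(t))/2Tel(t)` inside
`½Tel(t)/2Tel(t) ⊆ V/2Tel(t)`, where `V = ℚ ⊗ L`. -/
noncomputable def Amod {L : Type*} [AddCommGroup L] (t g : Module.End ℤ L) :
    Submodule ℤ ((ℚ ⊗[ℤ] L) ⧸ twoTelV t) :=
  Submodule.map (twoTelV t).mkQ
    (Submodule.map ((g.baseChange ℚ).restrictScalars ℤ - 1) (halfTelV t))

theorem toQL_injective (L : Type*) [AddCommGroup L] [Module.Free ℤ L] :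
    Function.Injective (toQL L) :=
  Module.Flat.tensorProduct_mk_injective ℤ L ℚ

theorem mem_eigP {L : Type*} [AddCommGroup L] {t : Module.End ℤ L} {x : L} :
    x ∈ eigP t ↔ t x = x := by
  simp [eigP, sub_eq_zero]

theorem mem_eigM {L : Type*} [AddCommGroup L] {t : Module.End ℤ L} {x : L} :
    x ∈ eigM t ↔ t x = -x := by
  simp [eigM, add_eq_zero_iff_eq_neg]

/-- `A(g)` consists of the classes of `½(g - 1)(p + m)` with `p ∈ L^+(t)` and `m ∈ L^-(t)`. -/
theorem mem_Amod {L : Type*} [AddCommGroup L] {t g : Module.End ℤ L}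
    {v : (ℚ ⊗[ℤ] L) ⧸ twoTelV t} :
    v ∈ Amod t g ↔ ∃ p m : L, t p = p ∧ t m = -m ∧
      (twoTelV t).mkQ ((2 : ℚ)⁻¹ • toQL L (g (p + m) - (p + m))) = v := by
  have key (x : L) : ((g.baseChange ℚ).restrictScalars ℤ - 1 : Module.End ℤ (ℚ ⊗[ℤ] L))
      (((2 : ℚ)⁻¹ • toQL L) x) = (2 : ℚ)⁻¹ • toQL L (g x - x) := by
    have hg : (g.baseChange ℚ) (toQL L x) = toQL L (g x) := LinearMap.baseChange_tmul ..
    simp [hg, smul_sub]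
  constructor
  · rintro ⟨-, ⟨-, ⟨x, hx, rfl⟩, rfl⟩, rfl⟩
    obtain ⟨p, hp, m, hm, rfl⟩ := Submodule.mem_sup.mp hx
    exact ⟨p, m, mem_eigP.mp hp, mem_eigM.mp hm, by rw [key]⟩
  · rintro ⟨p, m, hp, hm, rfl⟩
    exact ⟨_, ⟨_, ⟨p + m, Submodule.add_mem_sup (mem_eigP.mpr hp) (mem_eigM.mpr hm), rfl⟩, rfl⟩,
      by rw [key]⟩

theorem mem_twoTelV {L : Type*} [AddCommGroup L] {t : Module.End ℤ L} {x : ℚ ⊗[ℤ] L} :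
    x ∈ twoTelV t ↔ ∃ p m : L, t p = p ∧ t m = -m ∧ toQL L ((2 : ℤ) • (p + m)) = x := by
  constructor
  · rintro ⟨-, ⟨y, hy, rfl⟩, rfl⟩
    obtain ⟨p, hp, m, hm, rfl⟩ := Submodule.mem_sup.mp hy
    exact ⟨p, m, mem_eigP.mp hp, mem_eigM.mp hm, rfl⟩
  · rintro ⟨p, m, hp, hm, rfl⟩
    exact ⟨_, ⟨p + m, Submodule.add_mem_sup (mem_eigP.mpr hp) (mem_eigM.mpr hm), rfl⟩, rfl⟩

/-- In `½Tel(t)/2Tel(t)` (inside `ℚ ⊗ L`), the commutator submodules `A(t)` and `A(u)`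
intersect trivially: `A(t) ∩ A(u) = 0`. -/
theorem amod_t_inf_amod_u_eq_bot {L : Type*} [AddCommGroup L]
    [Module.Free ℤ L] [Module.Finite ℤ L] (n : ℕ)
    (hrank : Module.finrank ℤ L = 2 * n)
    (t u : Module.End ℤ L) (ht : t * t = 1) (hu : u * u = 1)
    (hz : (t * u) * (t * u) = -1) :
    Amod t t ⊓ Amod t u = ⊥ := by
  have hut (x : L) : t (u x) = -u (t x) := by
    have h := LinearMap.congr_fun hz (u (t x))
    have hu' (y : L) : u (u y) = y := LinearMap.congr_fun hu y
    have ht' (y : L) : t (t y) = y := LinearMap.congr_fun ht y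
    simpa [hu', ht'] using h
  have huu (x : L) : u (u x) = x := LinearMap.congr_fun hu x
  rw [eq_bot_iff]
  rintro v ⟨hvt, hvu⟩
  obtain ⟨p, m, hp, hm, rfl⟩ := mem_Amod.mp hvt
  obtain ⟨p', m', hp', hm', hv⟩ := mem_Amod.mp hvu
  rw [← hv, Submodule.mem_bot, Submodule.mkQ_apply, Submodule.Quotient.mk_eq_zero, mem_twoTelV]
  rw [Submodule.mkQ_apply, Submodule.mkQ_apply, Submodule.Quotient.eq, mem_twoTelV] at hv
  obtain ⟨q, r, hq, hr, h⟩ := hv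
  have h4 : (4 : ℤ) • (q + r) = (u (p' + m') - (p' + m')) - (t (p + m) - (p + m)) := by
    apply toQL_injective L
    rw [← smul_sub, ← map_sub, eq_inv_smul_iff₀ two_ne_zero] at h
    rw [← h, two_smul, ← two_zsmul, ← map_zsmul, smul_smul]
    norm_num
  have h4t := congrArg t h4
  simp only [map_zsmul, map_add, map_sub, map_neg, hp, hm, hp', hm', hq, hr, hut] at h4 h4t
  have h8 : (2 : ℤ) • (u m' - p') = (2 : ℤ) • ((4 : ℤ) • q) := by
    linear_combination (norm := module) (-1 : ℤ) • h4 - h4t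
  have hc : u m' - p' = (4 : ℤ) • q := smul_right_injective L two_ne_zero h8
  refine ⟨q, -u q, hq, by rw [map_neg, hut, hq], ?_⟩
  have huc : m' - u p' = (4 : ℤ) • u q := by
    rw [← map_zsmul, ← hc, map_sub, huu]
  rw [eq_inv_smul_iff₀ two_ne_zero, two_smul, ← map_add]
  congr 1
  rw [map_add]
  linear_combination (norm := module) huc - hc
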